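/- arXiv:1204.2504 — 2 statements merged into one kernel-verified Lean document; each statement's English description precedes it below -/
import Mathlib

section
/- The nonlinearity operator N, which sends a C^2 orientation-preserving diffeomorphism φ of [0,1] with φ(0)=0, φ(1)=1 and Dφ>0 to N_φ = D log Dφ ∈ C^0([0,1],ℝ), is a bijection onto C^0([0,1],ℝ). Its inverse is given explicitly by the formula N^{-1}_g(x) = (∫_0^x exp(∫_0^r g(t)dt) dr) / (∫_0^1 exp(∫_0^r g(t)dt) dr): for every continuous g:[0,1]→ℝ this formula defines a C^2 orientation-preserving diffeomorphism φ of [0,1] fixing 0 and 1 with N_φ = g, and φ is the unique such diffeomorphism. -/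
/-- The explicit inverse of the nonlinearity operator:
`N⁻¹_g(x) = (∫_0^x exp(∫_0^r g(t) dt) dr) / (∫_0^1 exp(∫_0^r g(t) dt) dr)`. -/
noncomputable def Ninv (g : ℝ → ℝ) (x : ℝ) : ℝ :=
  (∫ r in (0:ℝ)..x, Real.exp (∫ t in (0:ℝ)..r, g t)) /
  (∫ r in (0:ℝ)..(1:ℝ), Real.exp (∫ t in (0:ℝ)..r, g t))

/-- The nonlinearity `N_φ = D log Dφ` of a map of `[0,1]`. -/
noncomputable def nonlin (φ : ℝ → ℝ) (x : ℝ) : ℝ :=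
  derivWithin (fun y => Real.log (derivWithin φ (Set.Icc 0 1) y)) (Set.Icc 0 1) x

open Set

lemma hasDerivWithinAt_integral_Icc {a b : ℝ} {f : ℝ → ℝ} (hf : ContinuousOn f (Icc a b))
    {x : ℝ} (hx : x ∈ Icc a b) :
    HasDerivWithinAt (fun u => ∫ t in a..u, f t) (f x) (Icc a b) x := by
  have : Fact (x ∈ Icc a b) := ⟨hx⟩
  refine intervalIntegral.integral_hasDerivWithinAt_right
    (ContinuousOn.intervalIntegrable ?_)
    (hf.stronglyMeasurableAtFilter_nhdsWithin measurableSet_Icc x) (hf x hx)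
  rw [uIcc_of_le hx.1]
  exact hf.mono (Icc_subset_Icc_right hx.2)

lemma contDiffOn_succ_of_hasDerivWithinAt {a b : ℝ} (hab : a < b) {f f' : ℝ → ℝ} {n : ℕ}
    (h : ∀ x ∈ Icc a b, HasDerivWithinAt f (f' x) (Icc a b) x)
    (hf' : ContDiffOn ℝ n f' (Icc a b)) : ContDiffOn ℝ (n + 1) f (Icc a b) := by
  have hu := uniqueDiffOn_Icc hab
  rw [contDiffOn_succ_iff_derivWithin hu]
  refine ⟨fun x hx => (h x hx).differentiableWithinAt, by simp, ?_⟩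
  exact hf'.congr fun x hx => (h x hx).derivWithin (hu x hx)

lemma sub_eq_sub_of_hasDerivWithinAt_eq {a b : ℝ} (hab : a < b) {f h f' : ℝ → ℝ}
    (hf : ∀ x ∈ Icc a b, HasDerivWithinAt f (f' x) (Icc a b) x)
    (hh : ∀ x ∈ Icc a b, HasDerivWithinAt h (f' x) (Icc a b) x) {x : ℝ} (hx : x ∈ Icc a b) :
    f x - h x = f a - h a := by
  have hd : ∀ y ∈ Icc a b, HasDerivWithinAt (fun y => f y - h y) 0 (Icc a b) y := fun y hy => by
    simpa using (hf y hy).fun_sub (hh y hy)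
  exact constant_of_derivWithin_zero (fun y hy => (hd y hy).differentiableWithinAt)
    (fun y hy => (hd y (Ico_subset_Icc_self hy)).derivWithin
      (uniqueDiffOn_Icc hab y (Ico_subset_Icc_self hy))) x hx

lemma hasDerivWithinAt_exp_integral {g : ℝ → ℝ} (hg : ContinuousOn g (Icc 0 1))
    {x : ℝ} (hx : x ∈ Icc (0 : ℝ) 1) :
    HasDerivWithinAt (fun r => Real.exp (∫ t in (0 : ℝ)..r, g t))
      (Real.exp (∫ t in (0 : ℝ)..x, g t) * g x) (Icc 0 1) x :=
  (hasDerivWithinAt_integral_Icc hg hx).exp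

lemma continuousOn_exp_integral {g : ℝ → ℝ} (hg : ContinuousOn g (Icc 0 1)) :
    ContinuousOn (fun r => Real.exp (∫ t in (0 : ℝ)..r, g t)) (Icc 0 1) :=
  fun _ hx => (hasDerivWithinAt_exp_integral hg hx).continuousWithinAt

lemma integral_exp_integral_pos {g : ℝ → ℝ} (hg : ContinuousOn g (Icc 0 1)) :
    0 < ∫ r in (0 : ℝ)..1, Real.exp (∫ t in (0 : ℝ)..r, g t) := by
  refine intervalIntegral.intervalIntegral_pos_of_pos_on
    (ContinuousOn.intervalIntegrable ?_) (fun _ _ => Real.exp_pos _) one_pos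
  rw [uIcc_of_le zero_le_one]
  exact continuousOn_exp_integral hg

lemma hasDerivWithinAt_Ninv {g : ℝ → ℝ} (hg : ContinuousOn g (Icc 0 1))
    {x : ℝ} (hx : x ∈ Icc (0 : ℝ) 1) :
    HasDerivWithinAt (Ninv g) (Real.exp (∫ t in (0 : ℝ)..x, g t) /
      ∫ r in (0 : ℝ)..1, Real.exp (∫ t in (0 : ℝ)..r, g t)) (Icc 0 1) x :=
  (hasDerivWithinAt_integral_Icc (continuousOn_exp_integral hg) hx).div_const _

lemma contDiffOn_Ninv {g : ℝ → ℝ} (hg : ContinuousOn g (Icc 0 1)) :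
    ContDiffOn ℝ 2 (Ninv g) (Icc 0 1) := by
  have hE : ContDiffOn ℝ 1 (fun r => Real.exp (∫ t in (0 : ℝ)..r, g t)) (Icc 0 1) := by
    simpa using contDiffOn_succ_of_hasDerivWithinAt (n := 0) one_pos
      (fun x hx => hasDerivWithinAt_exp_integral hg hx)
      (contDiffOn_zero.2 ((continuousOn_exp_integral hg).mul hg))
  have h := contDiffOn_succ_of_hasDerivWithinAt (n := 1) one_pos
    (fun x hx => hasDerivWithinAt_Ninv hg hx) (hE.div_const _)
  norm_num at h
  exact h

lemma nonlin_Ninv {g : ℝ → ℝ} (hg : ContinuousOn g (Icc 0 1))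
    {x : ℝ} (hx : x ∈ Icc (0 : ℝ) 1) : nonlin (Ninv g) x = g x := by
  have hu := uniqueDiffOn_Icc (zero_lt_one (α := ℝ))
  have hlog : EqOn (fun y => Real.log (derivWithin (Ninv g) (Icc 0 1) y))
      (fun y => (∫ t in (0 : ℝ)..y, g t) -
        Real.log (∫ r in (0 : ℝ)..1, Real.exp (∫ t in (0 : ℝ)..r, g t))) (Icc 0 1) := by
    intro y hy
    simp only [(hasDerivWithinAt_Ninv hg hy).derivWithin (hu y hy)]
    rw [Real.log_div (Real.exp_ne_zero _) (integral_exp_integral_pos hg).ne', Real.log_exp]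
  rw [nonlin, derivWithin_congr hlog (hlog hx)]
  exact ((hasDerivWithinAt_integral_Icc hg hx).sub_const _).derivWithin (hu x hx)

/-- Integrating `D log Dφ = g` once determines `Dφ` up to its value at `0`. -/
lemma derivWithin_eq_of_nonlin_eq {g φ : ℝ → ℝ} (hg : ContinuousOn g (Icc 0 1))
    (hφ : ContDiffOn ℝ 2 φ (Icc 0 1))
    (hpos : ∀ x ∈ Icc (0 : ℝ) 1, 0 < derivWithin φ (Icc 0 1) x)
    (hN : ∀ x ∈ Icc (0 : ℝ) 1, nonlin φ x = g x) {x : ℝ} (hx : x ∈ Icc (0 : ℝ) 1) :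
    derivWithin φ (Icc 0 1) x =
      derivWithin φ (Icc 0 1) 0 * Real.exp (∫ t in (0 : ℝ)..x, g t) := by
  have hu := uniqueDiffOn_Icc (zero_lt_one (α := ℝ))
  have hD : DifferentiableOn ℝ (derivWithin φ (Icc 0 1)) (Icc 0 1) :=
    (hφ.derivWithin (m := 1) hu (by norm_num)).differentiableOn one_ne_zero
  have hL : ∀ y ∈ Icc (0 : ℝ) 1, HasDerivWithinAt
      (fun y => Real.log (derivWithin φ (Icc 0 1) y)) (g y) (Icc 0 1) y := fun y hy => by
    rw [← hN y hy]
    exact ((hD y hy).log (hpos y hy).ne').hasDerivWithinAt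
  have h := sub_eq_sub_of_hasDerivWithinAt_eq one_pos hL
    (fun y hy => hasDerivWithinAt_integral_Icc hg hy) hx
  simp only [intervalIntegral.integral_same, sub_zero] at h
  rw [← Real.exp_log (hpos x hx), sub_eq_iff_eq_add.1 h, Real.exp_add,
    Real.exp_log (hpos 0 (left_mem_Icc.2 zero_le_one))]

lemma eqOn_Ninv_of_nonlin_eq {g φ : ℝ → ℝ} (hg : ContinuousOn g (Icc 0 1))
    (hφ : ContDiffOn ℝ 2 φ (Icc 0 1)) (h0 : φ 0 = 0) (h1 : φ 1 = 1)
    (hpos : ∀ x ∈ Icc (0 : ℝ) 1, 0 < derivWithin φ (Icc 0 1) x)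
    (hN : ∀ x ∈ Icc (0 : ℝ) 1, nonlin φ x = g x) : EqOn φ (Ninv g) (Icc 0 1) := by
  have hd : ∀ y ∈ Icc (0 : ℝ) 1, HasDerivWithinAt φ
      (derivWithin φ (Icc 0 1) 0 * Real.exp (∫ t in (0 : ℝ)..y, g t)) (Icc 0 1) y :=
    fun y hy => by
      rw [← derivWithin_eq_of_nonlin_eq hg hφ hpos hN hy]
      exact (hφ.differentiableOn two_ne_zero y hy).hasDerivWithinAt
  have key : ∀ y ∈ Icc (0 : ℝ) 1, φ y = derivWithin φ (Icc 0 1) 0 *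
      ∫ r in (0 : ℝ)..y, Real.exp (∫ t in (0 : ℝ)..r, g t) := fun y hy => by
    have h := sub_eq_sub_of_hasDerivWithinAt_eq one_pos hd (fun z hz =>
      (hasDerivWithinAt_integral_Icc (continuousOn_exp_integral hg) hz).const_mul _) hy
    simpa [h0, sub_eq_zero] using h
  intro x hx
  have hone := key 1 (right_mem_Icc.2 zero_le_one)
  rw [h1] at hone
  rw [key x hx, Ninv, eq_div_iff (integral_exp_integral_pos hg).ne', mul_right_comm, ← hone,
    one_mul]

/-- The nonlinearity operator is a bijection from C² orientation-preserving
diffeomorphisms of `[0,1]` fixing `0` and `1` onto `C⁰([0,1],ℝ)`, with explicit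
inverse given by `Ninv`. -/
theorem nonlinearity_operator_bijection (g : ℝ → ℝ)
    (hg : ContinuousOn g (Set.Icc 0 1)) :
    (ContDiffOn ℝ 2 (Ninv g) (Set.Icc 0 1) ∧
      Ninv g 0 = 0 ∧ Ninv g 1 = 1 ∧
      (∀ x ∈ Set.Icc (0:ℝ) 1, 0 < derivWithin (Ninv g) (Set.Icc 0 1) x) ∧
      (∀ x ∈ Set.Icc (0:ℝ) 1, nonlin (Ninv g) x = g x)) ∧
    ∀ φ : ℝ → ℝ, ContDiffOn ℝ 2 φ (Set.Icc 0 1) → φ 0 = 0 → φ 1 = 1 →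
      (∀ x ∈ Set.Icc (0:ℝ) 1, 0 < derivWithin φ (Set.Icc 0 1) x) →
      (∀ x ∈ Set.Icc (0:ℝ) 1, nonlin φ x = g x) →
      Set.EqOn φ (Ninv g) (Set.Icc 0 1) := by
  refine ⟨⟨contDiffOn_Ninv hg, by simp [Ninv], div_self (integral_exp_integral_pos hg).ne',
    fun x hx => ?_, fun x hx => nonlin_Ninv hg hx⟩,
    fun φ hφ h0 h1 hpos hN => eqOn_Ninv_of_nonlin_eq hg hφ h0 h1 hpos hN⟩
  rw [(hasDerivWithinAt_Ninv hg hx).derivWithin (uniqueDiffOn_Icc one_pos x hx)]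
  exact div_pos (Real.exp_pos _) (integral_exp_integral_pos hg)
end

section
/- Let π>0, let φ be a C^2 orientation-preserving diffeomorphism of [0,1] fixing 0 and 1 with dist[φ] ≤ π, let t ∈ [0,1], and define φ_t(x) = (∫_0^x (Dφ(r))^{1-t} dr)/(∫_0^1 (Dφ(r))^{1-t} dr) (the convex combination (1−t)φ + t·id in the nonlinearity-induced linear structure). Then for every x ∈ [0,1]: φ_t(x) ≤ φ(x)^{1-t}·x^t·( t·e^{π(1-t)} + (1−t)·e^{πt} ), and φ_t(x) ≥ φ(x)^{1-t}·x^t·( t·e^{-π(1-t)} + (1−t)·e^{-πt} ). -/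
/-- `dist[φ] ≤ π`: the distortion bound `log (Dφ(y)/Dφ(x)) ≤ π` for all `x, y ∈ [0,1]`. -/
def DistBound (φ : ℝ → ℝ) (π : ℝ) : Prop :=
  ∀ x ∈ Set.Icc (0:ℝ) 1, ∀ y ∈ Set.Icc (0:ℝ) 1,
    Real.log (derivWithin φ (Set.Icc 0 1) y / derivWithin φ (Set.Icc 0 1) x) ≤ π

open Set intervalIntegral

/-- Jensen's inequality for the power `s ≤ 1` of a positive continuous function. -/
theorem integral_rpow_le_rpow_integral {a b s t : ℝ} (hab : a < b) (hs : 0 ≤ s) (ht : 0 ≤ t)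
    (hst : s + t = 1) {f : ℝ → ℝ} (hf : ContinuousOn f (Icc a b)) (hpos : ∀ r ∈ Icc a b, 0 < f r) :
    ∫ r in a..b, f r ^ s ≤ (∫ r in a..b, f r) ^ s * (b - a) ^ t := by
  have hu : uIcc a b = Icc a b := uIcc_of_le hab.le
  have hfi : IntervalIntegrable f MeasureTheory.volume a b :=
    ContinuousOn.intervalIntegrable (by rwa [hu])
  have hfsi : IntervalIntegrable (fun r => f r ^ s) MeasureTheory.volume a b :=
    ContinuousOn.intervalIntegrable
      (by rw [hu]; exact hf.rpow_const fun r hr => Or.inl (hpos r hr).ne')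
  have hL : 0 < b - a := sub_pos.2 hab
  have hI : 0 < ∫ r in a..b, f r :=
    intervalIntegral_pos_of_pos_on hfi (fun r hr => hpos r (Ioo_subset_Icc_self hr)) hab
  set c := (∫ r in a..b, f r) / (b - a) with hc
  have hcpos : 0 < c := div_pos hI hL
  have hIc : ∫ r in a..b, f r = c * (b - a) := by rw [hc]; field_simp
  have hpt : ∀ r ∈ Icc a b, f r ^ s ≤ c ^ s * (s / c * f r + t) := fun r hr => by
    have h := Real.geom_mean_le_arith_mean2_weighted hs ht
      (div_pos (hpos r hr) hcpos).le zero_le_one hst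
    rw [Real.one_rpow, mul_one, mul_one, Real.div_rpow (hpos r hr).le hcpos.le,
      div_le_iff₀ (Real.rpow_pos_of_pos hcpos s)] at h
    calc f r ^ s ≤ (s * (f r / c) + t) * c ^ s := h
      _ = _ := by ring
  calc ∫ r in a..b, f r ^ s ≤ ∫ r in a..b, c ^ s * (s / c * f r + t) :=
        integral_mono_on hab.le hfsi (((hfi.const_mul _).add intervalIntegrable_const).const_mul _)
          hpt
    _ = c ^ s * (s / c * (c * (b - a)) + (b - a) * t) := by
        rw [integral_const_mul, integral_add (hfi.const_mul _) intervalIntegrable_const,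
          integral_const_mul, hIc, integral_const, smul_eq_mul]
    _ = c ^ s * ((s + t) * (b - a)) := by field_simp
    _ = c ^ s * (b - a) ^ (s + t) := by rw [hst, one_mul, Real.rpow_one]
    _ = (∫ r in a..b, f r) ^ s * (b - a) ^ t := by
        rw [hIc, Real.mul_rpow hcpos.le hL.le, Real.rpow_add hL]; ring

/-- Reverse Jensen inequality for the power `s ≤ 1` of a positive continuous function whose values
have pairwise ratios at most `e ^ π`. -/
theorem exp_mul_rpow_integral_le_integral_rpow {a b s t π : ℝ} (hab : a < b) (hs : 0 ≤ s)
    (ht : 0 ≤ t) (hst : s + t = 1) {f : ℝ → ℝ} (hf : ContinuousOn f (Icc a b))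
    (hpos : ∀ r ∈ Icc a b, 0 < f r)
    (hratio : ∀ x ∈ Icc a b, ∀ y ∈ Icc a b, Real.log (f y / f x) ≤ π) :
    Real.exp (-(π * s * t)) * ((∫ r in a..b, f r) ^ s * (b - a) ^ t) ≤ ∫ r in a..b, f r ^ s := by
  have hu : uIcc a b = Icc a b := uIcc_of_le hab.le
  have hfi : IntervalIntegrable f MeasureTheory.volume a b :=
    ContinuousOn.intervalIntegrable (by rwa [hu])
  have hfsi : IntervalIntegrable (fun r => f r ^ s) MeasureTheory.volume a b :=
    ContinuousOn.intervalIntegrable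
      (by rw [hu]; exact hf.rpow_const fun r hr => Or.inl (hpos r hr).ne')
  have hL : 0 < b - a := sub_pos.2 hab
  have hI : 0 < ∫ r in a..b, f r :=
    intervalIntegral_pos_of_pos_on hfi (fun r hr => hpos r (Ioo_subset_Icc_self hr)) hab
  obtain ⟨p, hp, hmin⟩ := isCompact_Icc.exists_isMinOn (nonempty_Icc.2 hab.le) hf
  obtain ⟨q, hq, hmax⟩ := isCompact_Icc.exists_isMaxOn (nonempty_Icc.2 hab.le) hf
  have hm := hpos p hp
  have hM := hpos q hq
  have hA₁ : f p ^ s * (b - a) ≤ ∫ r in a..b, f r ^ s := by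
    have h := integral_mono_on hab.le (intervalIntegrable_const (c := f p ^ s)) hfsi
      fun r hr => Real.rpow_le_rpow hm.le (hmin hr) hs
    rwa [integral_const, smul_eq_mul, mul_comm] at h
  have hA₂ : f q ^ (-t) * (∫ r in a..b, f r) ≤ ∫ r in a..b, f r ^ s := by
    rw [← integral_const_mul]
    refine integral_mono_on hab.le (hfi.const_mul _) hfsi fun r hr => ?_
    calc f q ^ (-t) * f r ≤ f r ^ (-t) * f r :=
          mul_le_mul_of_nonneg_right
            (Real.rpow_le_rpow_of_nonpos (hpos r hr) (hmax hr) (neg_nonpos.2 ht)) (hpos r hr).le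
      _ = f r ^ (-t + 1) := by rw [Real.rpow_add (hpos r hr), Real.rpow_one]
      _ = f r ^ s := by congr 1; linarith
  have hB₁ : 0 < f p ^ s * (b - a) := mul_pos (Real.rpow_pos_of_pos hm s) hL
  have hB₂ : 0 < f q ^ (-t) * (∫ r in a..b, f r) := mul_pos (Real.rpow_pos_of_pos hM _) hI
  have hA : 0 < ∫ r in a..b, f r ^ s := hB₁.trans_le hA₁
  have hexp : Real.exp (-(π * s * t)) ≤ (f p ^ s) ^ t * (f q ^ (-t)) ^ s := by
    have h := hratio p hp q hq
    rw [Real.log_div hM.ne' hm.ne'] at h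
    rw [← Real.rpow_mul hm.le, ← Real.rpow_mul hM.le, Real.rpow_def_of_pos hm,
      Real.rpow_def_of_pos hM, ← Real.exp_add, Real.exp_le_exp]
    nlinarith [mul_le_mul_of_nonneg_right h (mul_nonneg hs ht)]
  calc Real.exp (-(π * s * t)) * ((∫ r in a..b, f r) ^ s * (b - a) ^ t)
      ≤ (f p ^ s) ^ t * (f q ^ (-t)) ^ s * ((∫ r in a..b, f r) ^ s * (b - a) ^ t) :=
        mul_le_mul_of_nonneg_right hexp
          (mul_pos (Real.rpow_pos_of_pos hI s) (Real.rpow_pos_of_pos hL t)).le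
    _ = (f p ^ s * (b - a)) ^ t * (f q ^ (-t) * ∫ r in a..b, f r) ^ s := by
        rw [Real.mul_rpow (Real.rpow_pos_of_pos hm s).le hL.le,
          Real.mul_rpow (Real.rpow_pos_of_pos hM _).le hI.le]
        ring
    _ ≤ (∫ r in a..b, f r ^ s) ^ t * (∫ r in a..b, f r ^ s) ^ s :=
        mul_le_mul (Real.rpow_le_rpow hB₁.le hA₁ ht) (Real.rpow_le_rpow hB₂.le hA₂ hs)
          (Real.rpow_pos_of_pos hB₂ s).le (Real.rpow_pos_of_pos hA t).le
    _ = ∫ r in a..b, f r ^ s := by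
        rw [← Real.rpow_add hA, add_comm t s, hst, Real.rpow_one]

/-- Bounds on the convex combination `φ_t = (1-t)φ + t·id` (taken in the
nonlinearity-induced linear structure, i.e. given by the explicit integral formula
`φ_t(x) = (∫_0^x (Dφ(r))^{1-t} dr)/(∫_0^1 (Dφ(r))^{1-t} dr)`):
`φ(x)^{1-t}·x^t·(t e^{-π(1-t)} + (1-t)e^{-πt}) ≤ φ_t(x) ≤
 φ(x)^{1-t}·x^t·(t e^{π(1-t)} + (1-t)e^{πt})`. -/
theorem convex_combination_with_id_bounds (π t : ℝ) (hπ : 0 < π)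
    (ht : t ∈ Set.Icc (0:ℝ) 1)
    (φ : ℝ → ℝ) (hφ : ContDiffOn ℝ 2 φ (Set.Icc 0 1))
    (h0 : φ 0 = 0) (h1 : φ 1 = 1)
    (hd : ∀ x ∈ Set.Icc (0:ℝ) 1, 0 < derivWithin φ (Set.Icc 0 1) x)
    (hdist : DistBound φ π) :
    ∀ x ∈ Set.Icc (0:ℝ) 1,
      (∫ r in (0:ℝ)..x, derivWithin φ (Set.Icc 0 1) r ^ (1 - t)) /
          (∫ r in (0:ℝ)..(1:ℝ), derivWithin φ (Set.Icc 0 1) r ^ (1 - t)) ≤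
        φ x ^ (1 - t) * x ^ t *
          (t * Real.exp (π * (1 - t)) + (1 - t) * Real.exp (π * t)) ∧
      φ x ^ (1 - t) * x ^ t *
          (t * Real.exp (-(π * (1 - t))) + (1 - t) * Real.exp (-(π * t))) ≤
        (∫ r in (0:ℝ)..x, derivWithin φ (Set.Icc 0 1) r ^ (1 - t)) /
          (∫ r in (0:ℝ)..(1:ℝ), derivWithin φ (Set.Icc 0 1) r ^ (1 - t)) := by
  obtain ⟨ht0, ht1⟩ := ht
  have hs0 : 0 ≤ 1 - t := sub_nonneg.2 ht1
  have hst : 1 - t + t = 1 := sub_add_cancel 1 t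
  intro x hx
  rcases hx.1.eq_or_lt with rfl | hx0
  · have hz : (0 : ℝ) ^ (1 - t) * (0 : ℝ) ^ t = 0 := by
      rcases eq_or_ne t 0 with rfl | h
      · simp
      · rw [Real.zero_rpow h, mul_zero]
    simp [h0, hz]
  set f := derivWithin φ (Icc 0 1)
  have hf : ContinuousOn f (Icc 0 1) :=
    hφ.continuousOn_derivWithin (uniqueDiffOn_Icc zero_lt_one) (by norm_num)
  have hsub : Icc 0 x ⊆ Icc (0 : ℝ) 1 := Icc_subset_Icc_right hx.2
  have hftc : ∀ y ∈ Icc (0 : ℝ) 1, ∫ r in (0 : ℝ)..y, f r = φ y := fun y hy => by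
    have hy' : Icc 0 y ⊆ Icc (0 : ℝ) 1 := Icc_subset_Icc_right hy.2
    rw [integral_eq_sub_of_hasDerivAt_of_le hy.1 (hφ.continuousOn.mono hy'), h0, sub_zero]
    · intro r hr
      have hr1 : r < 1 := hr.2.trans_le hy.2
      exact ((hφ.differentiableOn (by norm_num)) r ⟨hr.1.le, hr1.le⟩).hasDerivWithinAt.hasDerivAt
        (Icc_mem_nhds hr.1 hr1)
    · exact ContinuousOn.intervalIntegrable (by rw [uIcc_of_le hy.1]; exact hf.mono hy')
  have hAu := integral_rpow_le_rpow_integral hx0 hs0 ht0 hst (hf.mono hsub)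
    fun r hr => hd r (hsub hr)
  have hAl := exp_mul_rpow_integral_le_integral_rpow hx0 hs0 ht0 hst (hf.mono hsub)
    (fun r hr => hd r (hsub hr)) fun r hr y hy => hdist r (hsub hr) y (hsub hy)
  have hBu := integral_rpow_le_rpow_integral zero_lt_one hs0 ht0 hst hf hd
  have hBl := exp_mul_rpow_integral_le_integral_rpow zero_lt_one hs0 ht0 hst hf hd hdist
  rw [hftc x hx, sub_zero] at hAu hAl
  rw [hftc 1 (right_mem_Icc.2 zero_le_one), h1, sub_zero, Real.one_rpow, Real.one_rpow,
    mul_one] at hBu hBl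
  rw [mul_one] at hBl
  have hφx : 0 < φ x := by
    rw [← hftc x hx]
    exact intervalIntegral_pos_of_pos_on
      (ContinuousOn.intervalIntegrable (by rw [uIcc_of_le hx.1]; exact hf.mono hsub))
      (fun r hr => hd r (hsub (Ioo_subset_Icc_self hr))) hx0
  have hG : 0 < φ x ^ (1 - t) * x ^ t :=
    mul_pos (Real.rpow_pos_of_pos hφx _) (Real.rpow_pos_of_pos hx0 _)
  have hE : 0 < Real.exp (-(π * (1 - t) * t)) := Real.exp_pos _
  have hB : 0 < ∫ r in (0 : ℝ)..1, f r ^ (1 - t) := hE.trans_le hBl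
  have hle₁ : π * (1 - t) * t ≤ π * (1 - t) := mul_le_of_le_one_right (mul_nonneg hπ.le hs0) ht1
  have hle₂ : π * (1 - t) * t ≤ π * t := by nlinarith [mul_nonneg hπ.le (mul_nonneg ht0 ht0)]
  constructor
  · have hK : Real.exp (π * (1 - t) * t) ≤
        t * Real.exp (π * (1 - t)) + (1 - t) * Real.exp (π * t) := by
      linarith [mul_le_mul_of_nonneg_left (Real.exp_le_exp.2 hle₁) ht0,
        mul_le_mul_of_nonneg_left (Real.exp_le_exp.2 hle₂) hs0]
    calc _ ≤ φ x ^ (1 - t) * x ^ t / Real.exp (-(π * (1 - t) * t)) :=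
          div_le_div₀ hG.le hAu hE hBl
      _ = φ x ^ (1 - t) * x ^ t * Real.exp (π * (1 - t) * t) := by
          rw [Real.exp_neg, div_inv_eq_mul]
      _ ≤ _ := mul_le_mul_of_nonneg_left hK hG.le
  · have hK : t * Real.exp (-(π * (1 - t))) + (1 - t) * Real.exp (-(π * t)) ≤
        Real.exp (-(π * (1 - t) * t)) := by
      linarith [mul_le_mul_of_nonneg_left (Real.exp_le_exp.2 (neg_le_neg hle₁)) ht0,
        mul_le_mul_of_nonneg_left (Real.exp_le_exp.2 (neg_le_neg hle₂)) hs0]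
    rw [le_div_iff₀ hB]
    calc _ ≤ φ x ^ (1 - t) * x ^ t * Real.exp (-(π * (1 - t) * t)) * 1 :=
          mul_le_mul (mul_le_mul_of_nonneg_left hK hG.le) hBu hB.le (mul_pos hG hE).le
      _ = Real.exp (-(π * (1 - t) * t)) * (φ x ^ (1 - t) * x ^ t) := by ring
      _ ≤ _ := hAl
end
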